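/- arXiv:math/0508196 — 3 statements merged into one kernel-verified Lean document; each statement's English description precedes it below -/
import Mathlib

section
/- Let P be the left ideal ⟨-3+4y, x+1⟩ of ZQ₂₈. Then P is not a free ZQ₂₈-module. -/
open MonoidAlgebra

abbrev QR (n : ℕ) : Type := MonoidAlgebra ℤ (QuaternionGroup n)

noncomputable def Xq (n : ℕ) : QR n := of ℤ (QuaternionGroup n) (QuaternionGroup.a 1)
noncomputable def Yq (n : ℕ) : QR n := of ℤ (QuaternionGroup n) (QuaternionGroup.xa 0)

/-- the left ideal `⟨-3+4y, x+1⟩` of `ℤQ₂₈` -/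
noncomputable def P28 : Ideal (QR 7) :=
  Ideal.span {(-3 : QR 7) + (4 : QR 7) * Yq 7, Xq 7 + 1}

open Polynomial

/-- A character `e` of the cyclic subgroup of the quaternion group with values in a monoid `S`,
together with a compatible image `Y` of the generator `xa 0`, determines a homomorphism. -/
def quaternionLift {n : ℕ} {S : Type*} [Monoid S] (e : AddChar (ZMod (2 * n)) S) (Y : S)
    (hY : Y * Y = e n) (he : ∀ i, e i * Y = Y * e (-i)) : QuaternionGroup n →* S where
  toFun
    | .a i => e i
    | .xa i => Y * e i
  map_one' := e.map_zero_eq_one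
  map_mul' := by
    rintro (i | i) (j | j)
    · exact e.map_add_eq_mul i j
    · change Y * e (j - i) = e i * (Y * e j)
      rw [← mul_assoc, he, mul_assoc, ← e.map_add_eq_mul, neg_add_eq_sub]
    · change Y * e (i + j) = Y * e i * e j
      rw [e.map_add_eq_mul, mul_assoc]
    · change e (n + j - i) = Y * e i * (Y * e j)
      rw [mul_assoc, ← mul_assoc (e i), he, mul_assoc, ← mul_assoc, hY, ← e.map_add_eq_mul,
        ← e.map_add_eq_mul]
      congr 1
      ring

/-- Every element of `ℤQ₄ₙ` has the form `f(x) + y g(x)`. -/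
theorem exists_aeval_add_mul_aeval (n : ℕ) [NeZero n] (r : QR n) :
    ∃ f g : ℤ[X], r = aeval (Xq n) f + Yq n * aeval (Xq n) g := by
  have hX (i : ZMod (2 * n)) : of ℤ (QuaternionGroup n) (.a i) = Xq n ^ i.val := by
    rw [Xq, ← map_pow, QuaternionGroup.a_one_pow, ZMod.natCast_zmod_val]
  induction r using MonoidAlgebra.induction_on with
  | of q =>
    rcases q with i | i
    · exact ⟨X ^ i.val, 0, by simpa using hX i⟩
    · refine ⟨0, X ^ i.val, ?_⟩
      have : (QuaternionGroup.xa i : QuaternionGroup n) = .xa 0 * .a i := by simp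
      rw [this, map_mul, hX]
      simp [Yq]
  | add r s hr hs =>
    obtain ⟨f, g, rfl⟩ := hr
    obtain ⟨f', g', rfl⟩ := hs
    exact ⟨f + f', g + g', by simp only [map_add, mul_add]; abel⟩
  | smul c r hr =>
    obtain ⟨f, g, rfl⟩ := hr
    exact ⟨c • f, c • g, by simp [(Int.cast_commute c (Yq n)).left_comm]⟩

/-- A free left ideal of a nonzero ring that is finite over `ℤ` is principal. -/
theorem Ideal.exists_eq_span_singleton_of_free {R : Type*} [Ring R] [Nontrivial R]
    [Module.Finite ℤ R] (I : Ideal R) [Module.Free R I] : ∃ b : R, I = Ideal.span {b} := by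
  have : IsNoetherianRing R := isNoetherian_of_tower ℤ inferInstance
  let b := Module.Free.chooseBasis R I
  have hli : LinearIndependent R (fun i => (b i : R)) :=
    b.linearIndependent.map' I.subtype I.ker_subtype
  have hcard := hli.cardinal_le_rank
  rw [Module.rank_self, Cardinal.le_one_iff_subsingleton] at hcard
  have hspan : I = Ideal.span (Set.range fun i => (b i : R)) := by
    have := congrArg (Submodule.map I.subtype) b.span_eq
    rw [Submodule.map_span, Submodule.map_top, I.range_subtype, ← Set.range_comp] at this
    exact this.symm
  rcases isEmpty_or_nonempty (Module.Free.ChooseBasisIndex R I) with h | ⟨⟨i⟩⟩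
  · exact ⟨0, by rw [hspan, Set.range_eq_empty]; simp⟩
  · have : Unique (Module.Free.ChooseBasisIndex R I) := uniqueOfSubsingleton i
    exact ⟨b default, by rwa [Set.range_unique] at hspan⟩

/-- The evaluation `x ↦ -1`, `y ↦ i` from `ℤQ₂₈` to the Gaussian integers. -/
noncomputable def gaussianEval : QR 7 →ₐ[ℤ] GaussianInt :=
  MonoidAlgebra.lift ℤ _ _ <| quaternionLift
    (AddChar.zmodChar (2 * 7) (by norm_num : (-1 : GaussianInt) ^ (2 * 7) = 1)) ⟨0, 1⟩
    (by decide) (by decide)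

theorem gaussianEval_Xq : gaussianEval (Xq 7) = -1 := by
  rw [gaussianEval, Xq, MonoidAlgebra.lift_of]
  decide

theorem gaussianEval_Yq : gaussianEval (Yq 7) = ⟨0, 1⟩ := by
  rw [gaussianEval, Yq, MonoidAlgebra.lift_of]
  decide

section Cyclotomic

variable {K : Type*} [Field K] {z : K}

theorem pow_seven_eq_neg_one (hz : IsPrimitiveRoot z 14) : z ^ 7 = -1 :=
  (hz.pow (by norm_num) (by norm_num : 14 = 7 * 2)).eq_neg_one_of_two_right

/-- The representation of `ℤQ₂₈` with `x ↦ diag(z, z⁻¹)` and `y² ↦ -1`, for `z` a primitive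
fourteenth root of unity. -/
noncomputable def matrixEval (hz : IsPrimitiveRoot z 14) :
    QR 7 →ₐ[ℤ] Matrix (Fin 2) (Fin 2) K :=
  let χ := AddChar.zmodChar (2 * 7) (hz.pow_eq_one : z ^ (2 * 7) = 1)
  MonoidAlgebra.lift ℤ _ _ <| quaternionLift
    { toFun i := Matrix.diagonal ![χ i, χ (-i)]
      map_zero_eq_one' := by ext i j; fin_cases i <;> fin_cases j <;> simp
      map_add_eq_mul' i j := by
        rw [Matrix.diagonal_mul_diagonal]
        congr 1
        ext k
        fin_cases k <;> simp [AddChar.map_add_eq_mul, add_comm] }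
    !![0, -1; 1, 0]
    (by
      have h : χ 7 = -1 := pow_seven_eq_neg_one hz
      have h' : χ (-7) = -1 := pow_seven_eq_neg_one hz
      simp [h, h', ← Matrix.ext_iff, Fin.forall_fin_two])
    (by intro i; simp [← Matrix.ext_iff, Fin.forall_fin_two, Matrix.vecMul_diagonal])

theorem matrixEval_Xq (hz : IsPrimitiveRoot z 14) :
    matrixEval hz (Xq 7) = Matrix.diagonal ![z, z⁻¹] := by
  rw [matrixEval, Xq, MonoidAlgebra.lift_of]
  change Matrix.diagonal ![z ^ 1, z ^ 13] = _
  rw [pow_one, eq_inv_of_mul_eq_one_left (a := z ^ 13) (b := z) (by rw [← pow_succ, hz.pow_eq_one])]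

theorem matrixEval_Yq (hz : IsPrimitiveRoot z 14) :
    matrixEval hz (Yq 7) = !![0, -1; 1, 0] := by
  rw [matrixEval, Yq, MonoidAlgebra.lift_of]
  change !![0, -1; 1, 0] * Matrix.diagonal ![z ^ 0, z ^ 0] = _
  ext i j
  fin_cases i <;> fin_cases j <;> simp

theorem det_matrixEval (hz : IsPrimitiveRoot z 14) (f g : ℤ[X]) :
    (matrixEval hz (aeval (Xq 7) f + Yq 7 * aeval (Xq 7) g)).det =
      aeval z f * aeval z⁻¹ f + aeval z g * aeval z⁻¹ g := by
  have h (p : ℤ[X]) : matrixEval hz (aeval (Xq 7) p) =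
      Matrix.diagonal ![aeval z p, aeval z⁻¹ p] := by
    rw [← aeval_algHom_apply, matrixEval_Xq]
    have := aeval_algHom_apply (Matrix.diagonalAlgHom ℤ (n := Fin 2) (α := K)) ![z, z⁻¹] p
    simp only [Matrix.diagonalAlgHom_apply] at this
    rw [this]
    congr 1
    ext k
    have := aeval_algHom_apply (Pi.evalAlgHom ℤ (fun _ : Fin 2 => K) k) ![z, z⁻¹] p
    fin_cases k <;> simpa using this.symm
  simp only [map_add, map_mul, h, matrixEval_Yq]
  simp [Matrix.det_fin_two, Matrix.vecMul_diagonal, mul_comm]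

theorem eval_cyclotomic_fourteen_eq_zero (hz : IsPrimitiveRoot z 14) :
    z ^ 6 - z ^ 5 + z ^ 4 - z ^ 3 + z ^ 2 - z + 1 = 0 := by
  have h1 : z + 1 ≠ 0 := fun h => by
    have : z ^ 2 = 1 := by linear_combination (z - 1) * h
    exact absurd (hz.dvd_of_pow_eq_one _ this) (by norm_num)
  refine (mul_eq_zero.1 ?_).resolve_left h1
  linear_combination pow_seven_eq_neg_one hz

/-- The combination `2 · 25 - 7 · 7 = 1` of multiples of `-3 + 4B` and `A + 1`, in any ring. -/
theorem bezout_combination_eq_one {S : Type*} [Ring S] {A B : S}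
    (hA : A ^ 6 - A ^ 5 + A ^ 4 - A ^ 3 + A ^ 2 - A + 1 = 0) (hB : B * B = -1) :
    2 * (-3 - 4 * B) * (-3 + 4 * B) +
      7 * (A ^ 5 - 2 * A ^ 4 + 3 * A ^ 3 - 4 * A ^ 2 + 5 * A - 6) * (A + 1) = 1 := by
  calc _ = 18 - 32 * (B * B) + 7 * (A ^ 6 - A ^ 5 + A ^ 4 - A ^ 3 + A ^ 2 - A + 1) - 49 := by
        grind
    _ = 1 := by rw [hA, hB]; norm_num

theorem exists_mem_P28_matrixEval_eq_one (hz : IsPrimitiveRoot z 14) :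
    ∃ p ∈ P28, matrixEval hz p = 1 := by
  refine ⟨(2 * (-3 - 4 * Yq 7)) * (-3 + 4 * Yq 7) +
    (7 * (Xq 7 ^ 5 - 2 * Xq 7 ^ 4 + 3 * Xq 7 ^ 3 - 4 * Xq 7 ^ 2 + 5 * Xq 7 - 6)) * (Xq 7 + 1),
    add_mem (Ideal.mul_mem_left _ _ (Ideal.subset_span (by simp)))
      (Ideal.mul_mem_left _ _ (Ideal.subset_span (by simp))), ?_⟩
  have hx := eval_cyclotomic_fourteen_eq_zero hz
  have hx' := eval_cyclotomic_fourteen_eq_zero hz.inv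
  simp only [inv_pow] at hx'
  have hY : matrixEval hz (Yq 7) * matrixEval hz (Yq 7) = -1 := by
    simp [matrixEval_Yq, ← Matrix.ext_iff, Fin.forall_fin_two]
  have hX : matrixEval hz (Xq 7) ^ 6 - matrixEval hz (Xq 7) ^ 5 + matrixEval hz (Xq 7) ^ 4 -
      matrixEval hz (Xq 7) ^ 3 + matrixEval hz (Xq 7) ^ 2 - matrixEval hz (Xq 7) + 1 = 0 := by
    simpa [matrixEval_Xq, Matrix.diagonal_pow, ← Matrix.ext_iff, Fin.forall_fin_two] using
      ⟨hx, hx'⟩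
  simp only [map_add, map_sub, map_mul, map_pow, map_neg, map_one, map_ofNat]
  exact bezout_combination_eq_one hX hY

end Cyclotomic

section Norm

open ComplexConjugate

variable {K : Type*} [Field K] [NumberField K]

theorem one_le_abs_norm_of_isIntegral {c : K} (hc : IsIntegral ℤ c) (h0 : c ≠ 0) :
    1 ≤ |Algebra.norm ℚ c| := by
  obtain ⟨m, hm⟩ := IsIntegrallyClosed.isIntegral_iff.1 (Algebra.isIntegral_norm ℚ hc)
  have hm' : (m : ℚ) = Algebra.norm ℚ c := by simpa using hm
  have : m ≠ 0 := by
    rintro rfl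
    exact Algebra.norm_ne_zero_iff.2 h0 (hm'.symm.trans Int.cast_zero)
  rw [← hm']
  exact_mod_cast Int.one_le_abs this

/-- If `a'` and `b'` are complex conjugates of algebraic integers `a`, `b` under every embedding
and `a a' + b b'` is a unit, then `a` or `b` vanishes. -/
theorem eq_zero_or_eq_zero_of_mul_add_mul_isUnit {a a' b b' e : K} (ha : IsIntegral ℤ a)
    (hb : IsIntegral ℤ b) (he : IsIntegral ℤ e)
    (ha' : ∀ φ : K →ₐ[ℚ] ℂ, φ a' = conj (φ a)) (hb' : ∀ φ : K →ₐ[ℚ] ℂ, φ b' = conj (φ b))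
    (h : e * (a * a' + b * b') = 1) : a = 0 ∨ b = 0 := by
  by_contra! hab
  have hnorm (c : K) : |(Algebra.norm ℚ c : ℝ)| = ∏ φ : K →ₐ[ℚ] ℂ, ‖φ c‖ := by
    rw [← norm_prod, ← Algebra.norm_eq_prod_embeddings ℚ ℂ c]
    simp
  have hcast {c : K} (hc : IsIntegral ℤ c) (h0 : c ≠ 0) : (1 : ℝ) ≤ |(Algebra.norm ℚ c : ℝ)| := by
    exact_mod_cast one_le_abs_norm_of_isIntegral hc h0
  have hprod : |(Algebra.norm ℚ e : ℝ)| * |(Algebra.norm ℚ (a * a' + b * b') : ℝ)| = 1 := by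
    rw [← abs_mul, ← Rat.cast_mul, ← map_mul, h]
    simp
  have hle : |(Algebra.norm ℚ a : ℝ)| ^ 2 + |(Algebra.norm ℚ b : ℝ)| ^ 2 ≤
      |(Algebra.norm ℚ (a * a' + b * b') : ℝ)| := by
    simp only [hnorm, ← Finset.prod_pow]
    have hterm (φ : K →ₐ[ℚ] ℂ) : ‖φ (a * a' + b * b')‖ = ‖φ a‖ ^ 2 + ‖φ b‖ ^ 2 := by
      rw [map_add, map_mul, map_mul, ha', hb', Complex.mul_conj', Complex.mul_conj']
      norm_cast
      exact abs_of_nonneg (by positivity)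
    have φ : K →ₐ[ℚ] ℂ := IsAlgClosed.lift
    refine Finset.prod_add_prod_le (Finset.mem_univ φ) (hterm φ).ge (fun ψ _ _ => ?_)
      (fun ψ _ _ => ?_) (fun ψ _ => by positivity) (fun ψ _ => by positivity)
    · rw [hterm]
      exact le_add_of_nonneg_right (by positivity)
    · rw [hterm]
      exact le_add_of_nonneg_left (by positivity)
  have hae := hcast ha hab.1
  have hbe := hcast hb hab.2
  have hee := hcast he (left_ne_zero_of_mul_eq_one h)
  nlinarith

theorem map_aeval_inv_eq_conj {z : K} {n : ℕ} [NeZero n] (hz : IsPrimitiveRoot z n) (f : ℤ[X])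
    (φ : K →ₐ[ℚ] ℂ) : φ (aeval z⁻¹ f) = conj (φ (aeval z f)) := by
  have hinv : φ z⁻¹ = conj (φ z) := by
    rw [map_inv₀, Complex.inv_eq_conj]
    exact (hz.map_of_injective φ.injective).norm'_eq_one (NeZero.ne n)
  have h1 (w : K) := aeval_algHom_apply (φ : K →+* ℂ).toIntAlgHom w f
  have h2 := aeval_algHom_apply (starRingEnd ℂ).toIntAlgHom (φ z) f
  simp only [RingHom.toIntAlgHom_apply, RingHom.coe_coe] at h1 h2
  rw [← h1, ← h1, hinv, h2]

end Norm

/-- An integral polynomial vanishing at a primitive fourteenth root of unity is divisible by the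
cyclotomic polynomial, whose value at `-1` is `7`. -/
theorem seven_dvd_eval_neg_one {K : Type*} [Field K] [CharZero K] {z : K}
    (hz : IsPrimitiveRoot z 14) {f : ℤ[X]} (hf : aeval z f = 0) : 7 ∣ f.eval (-1) := by
  have hdvd : cyclotomic 14 ℤ ∣ f := by
    rw [cyclotomic_eq_minpoly hz (by norm_num)]
    exact minpoly.isIntegrallyClosed_dvd (hz.isIntegral (by norm_num)) hf
  have h7 : (cyclotomic 14 ℤ).eval (-1) = 7 := by
    have : Fact (Nat.Prime 7) := ⟨by norm_num⟩
    have hexp := congrArg (eval (-1)) (cyclotomic_expand_eq_cyclotomic_mul (p := 2) (n := 7)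
      Nat.prime_two (by norm_num) ℤ)
    simpa [expand_eval, cyclotomic_prime, Finset.sum_range_succ, eq_comm] using hexp
  rw [← h7]
  exact eval_dvd hdvd

theorem dvd_gaussianEval_of_mem_P28 {p : QR 7} (hp : p ∈ P28) :
    (⟨-3, 4⟩ : GaussianInt) ∣ gaussianEval p := by
  have hle : P28 ≤ (Ideal.span {(⟨-3, 4⟩ : GaussianInt)}).comap gaussianEval := by
    rw [P28, Ideal.span_le]
    rintro q (rfl | rfl)
    · refine Ideal.mem_span_singleton.2 (dvd_of_eq ?_)
      simp only [map_add, map_neg, map_mul, map_ofNat, gaussianEval_Yq]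
      decide
    · simp [gaussianEval_Xq]
  exact Ideal.mem_span_singleton.1 (hle hp)

/-- A Gaussian integer associated to `-3 + 4i` has both coordinates prime to `7`. -/
theorem not_seven_dvd_of_associated {w : GaussianInt} (h : Associated (⟨-3, 4⟩ : GaussianInt) w) :
    ¬ 7 ∣ w.re ∧ ¬ 7 ∣ w.im := by
  obtain ⟨u, rfl⟩ := h
  have hu : (u : GaussianInt).norm = 1 :=
    (Zsqrtd.norm_eq_one_iff' (by norm_num) _).2 u.isUnit
  rw [Zsqrtd.norm_def] at hu
  simp only [Zsqrtd.re_mul, Zsqrtd.im_mul]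
  generalize (u : GaussianInt).re = p at *
  generalize (u : GaussianInt).im = q at *
  have hp : -1 ≤ p ∧ p ≤ 1 := by constructor <;> nlinarith [mul_self_nonneg q]
  have hq : -1 ≤ q ∧ q ≤ 1 := by constructor <;> nlinarith [mul_self_nonneg p]
  obtain ⟨hp1, hp2⟩ := hp
  obtain ⟨hq1, hq2⟩ := hq
  interval_cases p <;> interval_cases q <;> simp_all

theorem stmt14 : ¬ Module.Free (QR 7) P28 := by
  intro hfree
  obtain ⟨β, hβ⟩ := P28.exists_eq_span_singleton_of_free
  obtain ⟨f, g, hfg⟩ := exists_aeval_add_mul_aeval 7 β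
  have hassoc : Associated (⟨-3, 4⟩ : GaussianInt) (gaussianEval β) := by
    refine associated_of_dvd_dvd
      (dvd_gaussianEval_of_mem_P28 (hβ ▸ Ideal.mem_span_singleton_self β)) ?_
    have hmem : (-3 : QR 7) + 4 * Yq 7 ∈ P28 := Ideal.subset_span (by simp)
    rw [hβ] at hmem
    obtain ⟨γ, hγ⟩ := Submodule.mem_span_singleton.1 hmem
    refine ⟨gaussianEval γ, ?_⟩
    rw [mul_comm, ← map_mul, ← smul_eq_mul, hγ]
    simp only [map_add, map_neg, map_mul, map_ofNat, gaussianEval_Yq]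
    decide
  have hval (p : ℤ[X]) : gaussianEval (aeval (Xq 7) p) = (p.eval (-1) : ℤ) := by
    rw [← aeval_algHom_apply, gaussianEval_Xq]
    simpa using aeval_algebraMap_apply GaussianInt (-1 : ℤ) p
  have hcoord := not_seven_dvd_of_associated hassoc
  simp only [hfg, map_add, map_mul, hval, gaussianEval_Yq] at hcoord
  simp at hcoord
  obtain ⟨z, hz⟩ := (CyclotomicField.isCyclotomicExtension 14 ℚ).exists_isPrimitiveRoot
    (Set.mem_singleton 14) (by norm_num)
  obtain ⟨p, hp, hp1⟩ := exists_mem_P28_matrixEval_eq_one hz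
  rw [hβ] at hp
  obtain ⟨γ, rfl⟩ := Submodule.mem_span_singleton.1 hp
  obtain ⟨f', g', hfg'⟩ := exists_aeval_add_mul_aeval 7 γ
  have hdet := congrArg Matrix.det hp1
  rw [smul_eq_mul, map_mul, Matrix.det_mul, Matrix.det_one, hfg, hfg', det_matrixEval,
    det_matrixEval] at hdet
  have haeval {w : CyclotomicField 14 ℚ} (hw : IsIntegral ℤ w) (q : ℤ[X]) :
      IsIntegral ℤ (aeval w q) :=
    IsIntegral.of_mem_of_fg _ hw.fg_adjoin_singleton _ (aeval_mem_adjoin_singleton ℤ w)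
  have hzi : IsIntegral ℤ z := hz.isIntegral (by norm_num)
  have hzi' : IsIntegral ℤ z⁻¹ := hz.inv.isIntegral (by norm_num)
  rcases eq_zero_or_eq_zero_of_mul_add_mul_isUnit (haeval hzi f) (haeval hzi g)
    (((haeval hzi f').mul (haeval hzi' f')).add ((haeval hzi g').mul (haeval hzi' g')))
    (map_aeval_inv_eq_conj hz f) (map_aeval_inv_eq_conj hz g) hdet with h | h
  · exact hcoord.1 (seven_dvd_eval_neg_one hz h)
  · exact hcoord.2 (seven_dvd_eval_neg_one hz h)
end

section
/- Let K be the presentation complex of Q_{4n} = ⟨x, y | x^n y⁻², y x y x^{-n+1}⟩, n odd, and C(K̃) its cellular chain complex over ZQ_{4n} with second boundary map ∂₂ given by the Fox derivative (Jacobian) matrix of the two relators. Then the kernel of ∂₂: ZQ_{4n}² → ZQ_{4n}² is the cyclic submodule generated by σ = (1-y)·R̃₁ + (1-yx)·R̃₂, and the map sending 1 + ⟨N⟩ to σ is an isomorphism ZQ_{4n}/⟨N⟩ ≅ ker ∂₂. -/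
open MonoidAlgebra

/-- the norm element: sum of all group elements -/
noncomputable def Nelt (n : ℕ) [NeZero n] : QR n :=
  ∑ g : QuaternionGroup n, of ℤ (QuaternionGroup n) g

/-- right multiplication by a 2×2 matrix, as a left-linear map -/
noncomputable def rmul2 {A : Type*} [Ring A] (c11 c12 c21 c22 : A) :
    (A × A) →ₗ[A] A × A where
  toFun p := (p.1 * c11 + p.2 * c21, p.1 * c12 + p.2 * c22)
  map_add' p q := by
    simp only [Prod.fst_add, Prod.snd_add, add_mul, Prod.mk_add_mk, Prod.mk.injEq]
    constructor <;> abel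
  map_smul' r p := by
    simp only [Prod.smul_fst, Prod.smul_snd, smul_eq_mul, RingHom.id_apply, Prod.smul_mk,
      Prod.mk.injEq, mul_assoc, mul_add]

/-- the second boundary map of the chain complex of the universal cover of the presentation
complex of `⟨x, y | xⁿy⁻², yxyx^{-n+1}⟩`, given by the Fox derivative matrix of the relators:
`∂₂ R̃₁ = (1+x+⋯+x^{n-1})·x̃ + (-1-y)·ỹ`, `∂₂ R̃₂ = (y-1-x-⋯-x^{n-2})·x̃ + (1+yx)·ỹ`. -/
noncomputable def d2 (n : ℕ) : (QR n × QR n) →ₗ[QR n] QR n × QR n :=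
  rmul2 (∑ k ∈ Finset.range n, Xq n ^ k) (-1 - Yq n)
    (Yq n - ∑ k ∈ Finset.range (n - 1), Xq n ^ k) (1 + Yq n * Xq n)

/-- `σ = (1-y)·R̃₁ + (1-yx)·R̃₂` -/
noncomputable def sigma (n : ℕ) : QR n × QR n := (1 - Yq n, 1 - Yq n * Xq n)

open Polynomial

namespace QuaternionFox

/-- evaluation of integer polynomials at the rotation `x` -/
noncomputable abbrev rot (n : ℕ) : ℤ[X] →ₐ[ℤ] QR n := aeval (Xq n)

lemma Xq_pow (n k : ℕ) : Xq n ^ k = of ℤ (QuaternionGroup n) (QuaternionGroup.a k) := by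
  rw [Xq, ← map_pow, QuaternionGroup.a_one_pow]

lemma Xq_pow_order (n : ℕ) : Xq n ^ (2 * n) = 1 := by
  rw [Xq_pow, ZMod.natCast_self, ← QuaternionGroup.one_def, map_one]

lemma Xq_pow_mul_Xq_pow (n : ℕ) : Xq n ^ n * Xq n ^ n = 1 := by
  rw [← pow_add, ← two_mul, Xq_pow_order]

lemma Xq_mul_Xq_pow_pred (n : ℕ) [NeZero n] : Xq n * Xq n ^ (2 * n - 1) = 1 := by
  have := NeZero.pos n
  rw [← pow_succ', Nat.sub_add_cancel (by omega), Xq_pow_order]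

lemma Yq_mul_Yq (n : ℕ) : Yq n * Yq n = Xq n ^ n := by
  rw [Xq_pow, Yq, ← map_mul, QuaternionGroup.xa_mul_xa]; simp

lemma Xq_mul_Yq_mul_Xq (n : ℕ) : Xq n * (Yq n * Xq n) = Yq n := by
  rw [Xq, Yq, ← map_mul, ← map_mul]; simp

lemma Yq_mul_Xq_pow (n : ℕ) : Yq n * Xq n ^ n = Xq n ^ n * Yq n := by
  rw [← Yq_mul_Yq, mul_assoc]

lemma Yq_mul_Xq (n : ℕ) [NeZero n] : Yq n * Xq n = Xq n ^ (2 * n - 1) * Yq n := by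
  nth_rw 2 [← Xq_mul_Yq_mul_Xq n]
  rw [← mul_assoc, ← pow_succ, pow_succ', Xq_mul_Xq_pow_pred, one_mul]

lemma Yq_mul_Xq_mul_Yq (n : ℕ) [NeZero n] : Yq n * Xq n * Yq n = Xq n ^ (n - 1) := by
  have hn := NeZero.pos n
  rw [Yq_mul_Xq, mul_assoc, Yq_mul_Yq, ← pow_add,
    show 2 * n - 1 + n = n - 1 + 2 * n by omega, pow_add, Xq_pow_order, mul_one]

lemma Yq_mul_Xq_mul_self (n : ℕ) : Yq n * Xq n * (Yq n * Xq n) = Xq n ^ n := by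
  rw [mul_assoc, Xq_mul_Yq_mul_Xq, Yq_mul_Yq]

lemma Xq_pow_mul_Yq (n k : ℕ) :
    Xq n ^ k * Yq n = of ℤ (QuaternionGroup n) (QuaternionGroup.xa (-k)) := by
  rw [Xq_pow, Yq, ← map_mul]; simp

lemma exists_rot_add_rot_mul_Yq (n : ℕ) [NeZero n] (w : QR n) :
    ∃ f g : ℤ[X], w = rot n f + rot n g * Yq n := by
  induction w using MonoidAlgebra.induction_on with
  | of g =>
    rcases g with i | i
    · refine ⟨X ^ i.val, 0, ?_⟩
      simp [Xq_pow]
    · refine ⟨0, X ^ (-i).val, ?_⟩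
      simp only [map_zero, map_pow, aeval_X, Xq_pow_mul_Yq]
      simp
  | add v w hv hw =>
    obtain ⟨f, g, rfl⟩ := hv
    obtain ⟨f', g', rfl⟩ := hw
    exact ⟨f + f', g + g', by simp only [map_add, add_mul]; abel⟩
  | smul r w hw =>
    obtain ⟨f, g, rfl⟩ := hw
    exact ⟨r • f, r • g, by simp only [map_smul, smul_add, smul_mul_assoc]⟩

lemma dvd_of_rot_add_rot_mul_Yq_eq_zero {n : ℕ} [NeZero n] {f g : ℤ[X]}
    (h : rot n f + rot n g * Yq n = 0) :
    (X ^ (2 * n) - 1 : ℤ[X]) ∣ f ∧ (X ^ (2 * n) - 1 : ℤ[X]) ∣ g := by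
  have hpos : 2 * n ≠ 0 := by have := NeZero.ne n; omega
  have hm : (X ^ (2 * n) - 1 : ℤ[X]).Monic := by simpa using monic_X_pow_sub_C (1 : ℤ) hpos
  have hdeg : (X ^ (2 * n) - 1 : ℤ[X]).natDegree = 2 * n := by
    simpa using natDegree_X_pow_sub_C (n := 2 * n) (r := (1 : ℤ))
  have hlt (p : ℤ[X]) : (p %ₘ (X ^ (2 * n) - 1)).natDegree < 2 * n := by
    have := natDegree_modByMonic_lt p hm (by
      intro h1; rw [h1, natDegree_one] at hdeg; exact hpos hdeg.symm)
    rwa [hdeg] at this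
  have hrot (p : ℤ[X]) : rot n p = ∑ k ∈ Finset.range (2 * n),
      (p %ₘ (X ^ (2 * n) - 1)).coeff k • Xq n ^ k := by
    rw [← aeval_eq_sum_range' (hlt p)]
    conv_lhs => rw [← modByMonic_add_div p (X ^ (2 * n) - 1)]
    simp [Xq_pow_order]
  have hzero (p : ℤ[X])
      (hp : ∀ k < 2 * n, (p %ₘ (X ^ (2 * n) - 1)).coeff k = 0) : X ^ (2 * n) - 1 ∣ p := by
    rw [← modByMonic_eq_zero_iff_dvd hm]
    ext k
    rcases lt_or_ge k (2 * n) with hk | hk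
    · exact hp k hk
    · exact coeff_eq_zero_of_natDegree_lt ((hlt p).trans_le hk)
  rw [hrot f, hrot g, Finset.sum_mul] at h
  simp only [smul_mul_assoc, Xq_pow_mul_Yq] at h
  simp only [Xq_pow] at h
  have hsum (c : ℕ → ℤ) {k : ℕ} (hk : k < 2 * n) :
      ∑ i ∈ Finset.range (2 * n), c i • (if (i : ZMod (2 * n)) = k then (1 : ℤ) else 0) =
        c k := by
    rw [Finset.sum_eq_single_of_mem k (Finset.mem_range.mpr hk)]
    · simp
    · intro i hi hik
      rw [if_neg, smul_zero]
      intro h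
      have := congrArg ZMod.val h
      rw [ZMod.val_natCast_of_lt (Finset.mem_range.mp hi), ZMod.val_natCast_of_lt hk] at this
      exact hik this
  constructor
  · refine hzero f fun k hk => ?_
    have h' := congrArg (fun w => w.coeff (QuaternionGroup.a (k : ZMod (2 * n)))) h
    simp only [of_apply, MonoidAlgebra.coeff_add, MonoidAlgebra.coeff_sum,
      MonoidAlgebra.coeff_smul, MonoidAlgebra.coeff_zero, Finsupp.add_apply,
      Finsupp.finsetSum_apply, Finsupp.smul_apply, MonoidAlgebra.coeff_single,
      Finsupp.single_apply, Finsupp.zero_apply] at h'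
    simp only [QuaternionGroup.a.injEq, reduceCtorEq, if_false, smul_zero,
      Finset.sum_const_zero, add_zero] at h'
    rwa [hsum _ hk] at h'
  · refine hzero g fun k hk => ?_
    have h' := congrArg (fun w => w.coeff (QuaternionGroup.xa (-k : ZMod (2 * n)))) h
    simp only [of_apply, MonoidAlgebra.coeff_add, MonoidAlgebra.coeff_sum,
      MonoidAlgebra.coeff_smul, MonoidAlgebra.coeff_zero, Finsupp.add_apply,
      Finsupp.finsetSum_apply, Finsupp.smul_apply, MonoidAlgebra.coeff_single,
      Finsupp.single_apply, Finsupp.zero_apply] at h'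
    simp only [QuaternionGroup.xa.injEq, reduceCtorEq, if_false, smul_zero,
      Finset.sum_const_zero, zero_add, neg_inj] at h'
    rwa [hsum _ hk] at h'

lemma exists_Yq_mul_rot (n : ℕ) [NeZero n] (f : ℤ[X]) :
    ∃ g : ℤ[X], Yq n * rot n f = rot n g * Yq n := by
  refine ⟨f.comp (X ^ (2 * n - 1)), ?_⟩
  induction f using Polynomial.induction_on' with
  | add p q hp hq => simp only [map_add, mul_add, add_comp, add_mul, hp, hq]
  | monomial k c =>
    have : SemiconjBy (Yq n) (Xq n ^ k) ((Xq n ^ (2 * n - 1)) ^ k) :=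
      SemiconjBy.pow_right (Yq_mul_Xq n) k
    rw [← C_mul_X_pow_eq_monomial, ← smul_eq_C_mul, smul_comp, map_smul, map_smul,
      mul_smul_comm, smul_mul_assoc]
    simp [this.eq]

lemma rot_geom_sum (n k : ℕ) :
    rot n (∑ i ∈ Finset.range k, X ^ i) = ∑ i ∈ Finset.range k, Xq n ^ i := by
  simp

lemma X_pow_two_mul_sub_one (n : ℕ) :
    (X ^ (2 * n) - 1 : ℤ[X]) = (∑ i ∈ Finset.range n, X ^ i) * ((X - 1) * (X ^ n + 1)) := by
  rw [← mul_assoc, geom_sum_mul]; ring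

lemma X_pow_add_one_ne_zero (n : ℕ) : (X ^ n + 1 : ℤ[X]) ≠ 0 := fun h => by
  simpa using congrArg (Polynomial.eval 1) h

lemma X_sub_one_ne_zero : (X - 1 : ℤ[X]) ≠ 0 := by
  simpa using X_sub_C_ne_zero (1 : ℤ)

lemma X_pow_sub_one_ne_zero (n : ℕ) [NeZero n] : (X ^ n - 1 : ℤ[X]) ≠ 0 := by
  simpa using X_pow_sub_C_ne_zero (NeZero.pos n) (1 : ℤ)

/-- the `x̃`-component of `∂₂ σ = 0`, solved for the second summand -/
lemma one_sub_mul_fox (n : ℕ) [NeZero n] :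
    (1 - Yq n * Xq n) * (Yq n - ∑ k ∈ Finset.range (n - 1), Xq n ^ k) =
      -((1 - Yq n) * ∑ k ∈ Finset.range n, Xq n ^ k) := by
  obtain ⟨m, rfl⟩ := Nat.exists_eq_succ_of_ne_zero (NeZero.ne n)
  have h := Yq_mul_Xq_mul_Yq (m + 1)
  simp only [Nat.succ_eq_add_one, Nat.add_sub_cancel] at h ⊢
  have h1 : Xq (m + 1) * ∑ k ∈ Finset.range m, Xq (m + 1) ^ k =
      (∑ k ∈ Finset.range (m + 1), Xq (m + 1) ^ k) - 1 := by
    rw [Finset.sum_range_succ', Finset.mul_sum]; simp [pow_succ']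
  rw [sub_mul, one_mul, mul_sub, h, mul_assoc (Yq _), h1, sub_mul, one_mul, mul_sub, mul_one]
  nth_rw 2 [Finset.sum_range_succ]
  abel

/-- the `ỹ`-component of `∂₂ σ = 0` -/
lemma fox_snd (n : ℕ) :
    (1 - Yq n) * (-1 - Yq n) + (1 - Yq n * Xq n) * (1 + Yq n * Xq n) = 0 := by
  have h1 : (1 - Yq n) * (-1 - Yq n) = Yq n * Yq n - 1 := by noncomm_ring
  have h2 : (1 - Yq n * Xq n) * (1 + Yq n * Xq n) = 1 - Yq n * Xq n * (Yq n * Xq n) := by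
    noncomm_ring
  rw [h1, h2, Yq_mul_Yq, Yq_mul_Xq_mul_self]
  abel

/-- `(1 + y²)(1 + y)(1 - yx)`, with `y` collected on the right -/
lemma one_add_mul_one_sub (n : ℕ) [NeZero n] :
    (1 + Xq n ^ n) * ((1 + Yq n) * (1 - Yq n * Xq n)) =
      rot n ((1 + X ^ n) * (1 - X)) + rot n ((1 + X ^ n) * (1 - X ^ (2 * n - 1))) * Yq n := by
  have h1 : (1 + Yq n) * (1 - Yq n * Xq n) =
      1 + Yq n - Xq n ^ (2 * n - 1) * Yq n - Xq n ^ n * Xq n := by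
    rw [← Yq_mul_Yq, ← Yq_mul_Xq]; noncomm_ring
  have h2 : (1 + Xq n ^ n) * (Xq n ^ n * Xq n) = (1 + Xq n ^ n) * Xq n := by
    rw [← mul_assoc, add_mul, one_mul, Xq_pow_mul_Xq_pow, add_comm]
  rw [h1, mul_sub, h2]
  simp only [map_mul, map_add, map_sub, map_one, map_pow, aeval_X]
  noncomm_ring

lemma one_sub_mul_one_sub (n : ℕ) [NeZero n] :
    (1 + Xq n ^ n) * ((1 - Xq n) * (1 - Yq n * Xq n)) =
      (1 + Xq n ^ n) * ((1 + Yq n) * (1 - Yq n * Xq n)) := by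
  rw [one_add_mul_one_sub]
  have h1 : (1 - Xq n) * (1 - Yq n * Xq n) =
      1 - Xq n - Xq n ^ (2 * n - 1) * Yq n + Yq n := by
    rw [← Yq_mul_Xq, sub_mul, mul_sub (Xq n), Xq_mul_Yq_mul_Xq]; noncomm_ring
  rw [h1]
  simp only [map_mul, map_add, map_sub, map_one, map_pow, aeval_X]
  noncomm_ring

/-- the left annihilator of `1 + yx` -/
lemma exists_eq_of_mul_one_add_eq_zero {n : ℕ} [NeZero n] {w : QR n}
    (h : w * (1 + Yq n * Xq n) = 0) :
    ∃ t : ℤ[X], w = rot n t * ((1 + Xq n ^ n) * (1 - Yq n * Xq n)) := by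
  obtain ⟨f, g, rfl⟩ := exists_rot_add_rot_mul_Yq n w
  have hy : rot n g * Yq n = rot n (g * X) * (Yq n * Xq n) := by
    rw [map_mul, aeval_X, mul_assoc, Xq_mul_Yq_mul_Xq]
  have hexp : rot n (f + g * X ^ (n + 1)) + rot n ((f + g * X) * X ^ (2 * n - 1)) * Yq n = 0 := by
    rw [← h, hy]
    simp only [map_mul, map_add, map_pow, aeval_X]
    rw [mul_assoc _ (Xq n ^ (2 * n - 1)), ← Yq_mul_Xq]
    have := Yq_mul_Xq_mul_self n
    generalize Yq n * Xq n = z at *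
    rw [add_mul _ _ (1 + z), mul_assoc _ z, mul_add z, this, mul_one, pow_succ']
    noncomm_ring
  obtain ⟨⟨a, ha⟩, ⟨b, hb⟩⟩ := dvd_of_rot_add_rot_mul_Yq_eq_zero hexp
  have hxy : rot n f = - rot n (g * X) := by
    have h1 := congrArg (fun p => rot n (p * X)) hb
    simp only [map_mul, map_sub, map_pow, map_one, aeval_X, Xq_pow_order, sub_self,
      zero_mul] at h1
    rw [mul_assoc, ← pow_succ, pow_succ', Xq_mul_Xq_pow_pred, mul_one] at h1
    rw [eq_neg_iff_add_eq_zero, ← h1]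
    simp
  have hdvd : (X ^ (2 * n) - 1 : ℤ[X]) ∣ (g * X) * (X ^ n - 1) := by
    refine (dvd_of_rot_add_rot_mul_Yq_eq_zero (n := n) (g := 0) ?_).1
    have h1 := congrArg (rot n) ha
    simp only [map_mul, map_sub, map_pow, map_one, aeval_X, Xq_pow_order, sub_self,
      zero_mul, map_add, hxy] at h1
    rw [← h1, pow_succ']
    simp
    noncomm_ring
  obtain ⟨s, hs⟩ := hdvd
  have hs' : g * X = (1 + X ^ n) * s := by
    apply mul_right_cancel₀ (X_pow_sub_one_ne_zero n)
    rw [hs]; ring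
  refine ⟨-s, ?_⟩
  rw [hxy, hy, hs', mul_comm _ s]
  simp only [map_mul, map_add, map_pow, map_one, aeval_X, map_neg]
  noncomm_ring

/-- the elements of the kernel with vanishing first coordinate -/
lemma exists_of_fst_eq_zero {n : ℕ} [NeZero n] {q : QR n}
    (h1 : q * (Yq n - ∑ k ∈ Finset.range (n - 1), Xq n ^ k) = 0)
    (h2 : q * (1 + Yq n * Xq n) = 0) :
    ∃ r, 0 = r * (1 - Yq n) ∧ q = r * (1 - Yq n * Xq n) := by
  obtain ⟨t, rfl⟩ := exists_eq_of_mul_one_add_eq_zero h2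
  obtain ⟨g, hg⟩ := exists_Yq_mul_rot n (∑ i ∈ Finset.range n, X ^ i)
  have h3 : rot n (t * (1 + X ^ n) * ∑ i ∈ Finset.range n, X ^ i) +
      rot n (-(t * (1 + X ^ n) * g)) * Yq n = 0 := by
    rw [mul_assoc, mul_assoc, one_sub_mul_fox, ← rot_geom_sum, sub_mul, hg] at h1
    rw [← neg_eq_zero, ← h1]
    simp only [map_mul, map_add, map_pow, map_one, aeval_X, map_neg]
    noncomm_ring
  obtain ⟨u, hu⟩ := (dvd_of_rot_add_rot_mul_Yq_eq_zero h3).1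
  have ht : t = (X - 1) * u := by
    have hS : (∑ i ∈ Finset.range n, X ^ i : ℤ[X]) ≠ 0 := fun h => by
      have := geom_sum_mul (X : ℤ[X]) n
      rw [h, zero_mul] at this
      exact X_pow_sub_one_ne_zero n this.symm
    apply mul_right_cancel₀ (mul_ne_zero (X_pow_add_one_ne_zero n) hS)
    rw [X_pow_two_mul_sub_one] at hu
    linear_combination hu
  have hcomm : (1 - Xq n) * (1 + Xq n ^ n) = (1 + Xq n ^ n) * (1 - Xq n) := by
    simp only [sub_mul, mul_sub, mul_add, add_mul, one_mul, mul_one, ← pow_succ', ← pow_succ]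
    abel
  refine ⟨-(rot n u * ((1 + Xq n ^ n) * (1 + Yq n))), ?_, ?_⟩
  · have h4 : (1 + Yq n) * (1 - Yq n) = 1 - Xq n ^ n := by
      rw [← Yq_mul_Yq]; noncomm_ring
    have h5 : (1 + Xq n ^ n) * (1 - Xq n ^ n) = 0 := by
      rw [mul_sub, mul_one, add_mul, Xq_pow_mul_Xq_pow]; noncomm_ring
    rw [neg_mul, mul_assoc, mul_assoc, h4, h5]; simp
  · have h6 : rot n t = -(rot n u * (1 - Xq n)) := by
      rw [ht, mul_comm, map_mul, map_sub, aeval_X, map_one]; noncomm_ring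
    rw [h6, neg_mul, neg_mul, mul_assoc, ← mul_assoc (1 - Xq n), hcomm, mul_assoc (1 + _),
      one_sub_mul_one_sub, mul_assoc, mul_assoc]

/-- the elements of the kernel whose first coordinate is a multiple of `1 + x + ⋯ + x^{n-1}` -/
lemma exists_of_fst_eq_smul {n : ℕ} [NeZero n] {q : QR n} {c : ℤ}
    (h1 : (c • ∑ k ∈ Finset.range n, Xq n ^ k) * (∑ k ∈ Finset.range n, Xq n ^ k) +
      q * (Yq n - ∑ k ∈ Finset.range (n - 1), Xq n ^ k) = 0)
    (h2 : (c • ∑ k ∈ Finset.range n, Xq n ^ k) * (-1 - Yq n) + q * (1 + Yq n * Xq n) = 0) :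
    ∃ r, (c • ∑ k ∈ Finset.range n, Xq n ^ k) = r * (1 - Yq n) ∧
      q = r * (1 - Yq n * Xq n) := by
  suffices hc : c = 0 by
    subst hc
    rw [zero_smul] at h1 h2 ⊢
    rw [zero_mul, zero_add] at h1 h2
    exact exists_of_fst_eq_zero h1 h2
  have hS : (∑ k ∈ Finset.range n, Xq n ^ k) * (-1 - Yq n) +
      ((∑ k ∈ Finset.range n, Xq n ^ k) + Xq n ^ n - Yq n * Xq n) * (1 + Yq n * Xq n) = 0 := by
    have h3 : (∑ k ∈ Finset.range n, Xq n ^ k) * Yq n =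
        (∑ k ∈ Finset.range n, Xq n ^ k) * (Yq n * Xq n) + (Xq n ^ n - 1) * (Yq n * Xq n) := by
      rw [← geom_sum_mul, ← add_mul, ← mul_one_add, add_sub_cancel, mul_assoc,
        Xq_mul_Yq_mul_Xq]
    have h4 := Yq_mul_Xq_mul_self n
    rw [mul_sub, h3]
    generalize Yq n * Xq n = z at *
    rw [← h4]
    noncomm_ring
  obtain ⟨t, ht⟩ := exists_eq_of_mul_one_add_eq_zero (n := n)
    (w := q - c • ((∑ k ∈ Finset.range n, Xq n ^ k) + Xq n ^ n - Yq n * Xq n)) (by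
      have := congrArg (c • ·) hS
      simp only [smul_add, smul_zero, ← smul_mul_assoc] at this
      rw [sub_mul, sub_eq_zero]
      exact add_left_cancel (h2.trans this.symm))
  let ε : QR n →ₐ[ℤ] ℤ := MonoidAlgebra.lift ℤ ℤ (QuaternionGroup n) 1
  have hX : ε (Xq n) = 1 := by simp [ε, Xq]
  have hY : ε (Yq n) = 1 := by simp [ε, Yq]
  have e1 := congrArg ε h1
  have e2 := congrArg ε ht
  have hn := NeZero.pos n
  simp [hX, hY, Nat.cast_sub (Nat.one_le_iff_ne_zero.mpr hn.ne')] at e1 e2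
  rw [sub_eq_zero.mp e2] at e1
  have e3 : c * (2 * n) = 0 := by linear_combination e1
  rcases mul_eq_zero.mp e3 with h | h
  · exact h
  · omega

lemma mem_ker_sub {n : ℕ} [NeZero n] {p q : QR n} (r : QR n)
    (h1 : p * (∑ k ∈ Finset.range n, Xq n ^ k) +
      q * (Yq n - ∑ k ∈ Finset.range (n - 1), Xq n ^ k) = 0)
    (h2 : p * (-1 - Yq n) + q * (1 + Yq n * Xq n) = 0) :
    (p - r * (1 - Yq n)) * (∑ k ∈ Finset.range n, Xq n ^ k) +
      (q - r * (1 - Yq n * Xq n)) * (Yq n - ∑ k ∈ Finset.range (n - 1), Xq n ^ k) = 0 ∧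
    (p - r * (1 - Yq n)) * (-1 - Yq n) +
      (q - r * (1 - Yq n * Xq n)) * (1 + Yq n * Xq n) = 0 := by
  constructor
  · rw [sub_mul, sub_mul, mul_assoc r, mul_assoc r, one_sub_mul_fox, ← h1, mul_neg]
    abel
  · have h3 := congrArg (r * ·) (fox_snd n)
    rw [mul_add r, mul_zero] at h3
    rw [sub_mul, sub_mul, mul_assoc r, mul_assoc r, sub_add_sub_comm, h2, h3, sub_zero]

/-- the elements of the kernel whose first coordinate is a polynomial in `x` -/
lemma exists_of_fst_eq_rot {n : ℕ} [NeZero n] {f : ℤ[X]} {q : QR n}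
    (h1 : rot n f * (∑ k ∈ Finset.range n, Xq n ^ k) +
      q * (Yq n - ∑ k ∈ Finset.range (n - 1), Xq n ^ k) = 0)
    (h2 : rot n f * (-1 - Yq n) + q * (1 + Yq n * Xq n) = 0) :
    ∃ r, rot n f = r * (1 - Yq n) ∧ q = r * (1 - Yq n * Xq n) := by
  have h3 : rot n (f * ((1 + X ^ n) * (1 - X))) +
      rot n (f * ((1 + X ^ n) * (1 - X ^ (2 * n - 1)))) * Yq n = 0 := by
    have h4 : (1 + Yq n * Xq n) * ((1 - Yq n * Xq n) * (1 + Xq n ^ n)) = 0 := by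
      have h5 : (1 + Yq n * Xq n) * (1 - Yq n * Xq n) = 1 - Xq n ^ n := by
        rw [← Yq_mul_Xq_mul_self]; noncomm_ring
      have h6 : (1 - Xq n ^ n) * (1 + Xq n ^ n) = 1 - Xq n ^ n * Xq n ^ n := by noncomm_ring
      rw [← mul_assoc, h5, h6, Xq_pow_mul_Xq_pow, sub_self]
    have h7 : Commute ((1 + Yq n) * (1 - Yq n * Xq n)) (1 + Xq n ^ n) := by
      have hy : Commute (Yq n) (Xq n ^ n) := Yq_mul_Xq_pow n
      have hx : Commute (Xq n) (Xq n ^ n) := Commute.self_pow _ _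
      have hy' : Commute (1 + Yq n) (Xq n ^ n) := (Commute.one_left _).add_left hy
      have hx' : Commute (1 - Yq n * Xq n) (Xq n ^ n) :=
        (Commute.one_left _).sub_left (hy.mul_left hx)
      exact (Commute.one_right _).add_right (hy'.mul_left hx')
    have h8 : rot n f * (-1 - Yq n) * ((1 - Yq n * Xq n) * (1 + Xq n ^ n)) = 0 := by
      rw [eq_neg_of_add_eq_zero_left h2, neg_mul, mul_assoc, h4, mul_zero, neg_zero]
    rw [map_mul, map_mul (rot n) f, mul_assoc, ← mul_add, ← one_add_mul_one_sub, ← h7.eq,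
      ← neg_eq_zero, ← h8, mul_assoc (rot n f), ← mul_neg, mul_assoc (1 + Yq n), ← neg_mul,
      neg_add']
  obtain ⟨s, hs⟩ := (dvd_of_rot_add_rot_mul_Yq_eq_zero h3).1
  have hf : f = (∑ i ∈ Finset.range n, X ^ i) * -s := by
    apply mul_right_cancel₀ (mul_ne_zero (X_pow_add_one_ne_zero n) X_sub_one_ne_zero)
    rw [X_pow_two_mul_sub_one] at hs
    linear_combination -hs
  obtain ⟨k, hk⟩ := X_sub_C_dvd_sub_C_eval (a := 1) (p := -s)
  set c := (-s).eval 1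
  have hf' : rot n f = c • (∑ i ∈ Finset.range n, Xq n ^ i) + rot n k * (Xq n ^ n - 1) := by
    have h9 : f = c • (∑ i ∈ Finset.range n, X ^ i) + k * (X ^ n - 1) := by
      rw [hf, sub_eq_iff_eq_add.mp hk, ← geom_sum_mul (X : ℤ[X]) n, smul_eq_C_mul, C_1]
      ring
    rw [h9, map_add, map_smul, rot_geom_sum]
    simp
  have hr : rot n f - -(rot n k * (1 + Yq n)) * (1 - Yq n) =
      c • ∑ i ∈ Finset.range n, Xq n ^ i := by
    rw [hf', ← Yq_mul_Yq]; noncomm_ring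
  obtain ⟨g1, g2⟩ := mem_ker_sub (-(rot n k * (1 + Yq n))) h1 h2
  rw [hr] at g1 g2
  obtain ⟨r, hr1, hr2⟩ := exists_of_fst_eq_smul g1 g2
  refine ⟨r + -(rot n k * (1 + Yq n)), ?_, ?_⟩
  · rw [add_mul, ← hr1, ← hr, sub_add_cancel]
  · rw [add_mul, ← hr2, sub_add_cancel]

lemma ker_d2 (n : ℕ) [NeZero n] :
    LinearMap.ker (d2 n) = Submodule.span (QR n) {sigma n} := by
  refine le_antisymm ?_ ?_
  · rintro ⟨p, q⟩ h
    obtain ⟨h1, h2⟩ := Prod.mk.inj (LinearMap.mem_ker.mp h)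
    change p * _ + q * _ = 0 at h1
    change p * _ + q * _ = 0 at h2
    obtain ⟨f, g, hp⟩ := exists_rot_add_rot_mul_Yq n p
    obtain ⟨g1, g2⟩ := mem_ker_sub (-rot n g) h1 h2
    have hr : p - -rot n g * (1 - Yq n) = rot n (f + g) := by
      rw [hp, map_add]; noncomm_ring
    rw [hr] at g1 g2
    obtain ⟨r, hr1, hr2⟩ := exists_of_fst_eq_rot g1 g2
    refine Submodule.mem_span_singleton.mpr ⟨r + -rot n g, Prod.ext ?_ ?_⟩
    · change (r + -rot n g) * (1 - Yq n) = p
      rw [add_mul, ← hr1, ← hr, sub_add_cancel]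
    · change (r + -rot n g) * (1 - Yq n * Xq n) = q
      rw [add_mul, ← hr2, sub_add_cancel]
  · rw [Submodule.span_singleton_le_iff_mem, LinearMap.mem_ker]
    refine Prod.ext ?_ (fox_snd n)
    change (1 - Yq n) * _ + (1 - Yq n * Xq n) * _ = 0
    rw [one_sub_mul_fox, add_neg_cancel]

lemma Nelt_mul_of (n : ℕ) [NeZero n] (g : QuaternionGroup n) :
    Nelt n * of ℤ (QuaternionGroup n) g = Nelt n := by
  rw [Nelt, Finset.sum_mul]
  exact Fintype.sum_equiv (Equiv.mulRight g) _ _ fun h => by simp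

lemma mem_span_Nelt_of_mul_of_eq_self {n : ℕ} [NeZero n] {w : QR n}
    (h : ∀ g, w * of ℤ (QuaternionGroup n) g = w) : w ∈ Ideal.span {Nelt n} := by
  have hw : w = w.coeff 1 • Nelt n := by
    ext g
    conv_lhs => rw [← h g]
    rw [MonoidAlgebra.coeff_smul, Nelt, MonoidAlgebra.coeff_sum, Finsupp.smul_apply,
      Finsupp.finsetSum_apply]
    simp [of_apply, Finsupp.single_apply]
  rw [hw]
  exact (Ideal.span {Nelt n}).smul_of_tower_mem _ (Ideal.mem_span_singleton_self _)

lemma ker_toSpanSingleton_sigma (n : ℕ) [NeZero n] :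
    LinearMap.ker (LinearMap.toSpanSingleton (QR n) (QR n × QR n) (sigma n)) =
      Ideal.span {Nelt n} := by
  refine le_antisymm (fun w hw => ?_) ?_
  · obtain ⟨h1, h2⟩ := Prod.mk.inj (LinearMap.mem_ker.mp hw)
    have hy : w * Yq n = w := by
      change w * (1 - Yq n) = 0 at h1
      rwa [mul_sub, mul_one, sub_eq_zero, eq_comm] at h1
    have hx : w * Xq n = w := by
      have : w * (Yq n * Xq n) = w := by
        change w * (1 - Yq n * Xq n) = 0 at h2
        rwa [mul_sub, mul_one, sub_eq_zero, eq_comm] at h2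
      rwa [← mul_assoc, hy] at this
    have hpow (k : ℕ) : w * Xq n ^ k = w := by
      induction k with
      | zero => simp
      | succ k ih => rw [pow_succ, ← mul_assoc, ih, hx]
    refine mem_span_Nelt_of_mul_of_eq_self fun g => ?_
    rcases g with i | i
    · simpa [Xq_pow] using hpow i.val
    · have := Xq_pow_mul_Yq n (-i).val
      rw [ZMod.natCast_zmod_val, neg_neg] at this
      rw [← this, ← mul_assoc, hpow, hy]
  · rw [Ideal.span, Submodule.span_singleton_le_iff_mem, LinearMap.mem_ker]
    refine Prod.ext ?_ ?_
    · change Nelt n * (1 - Yq n) = 0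
      rw [mul_sub, mul_one, Yq, Nelt_mul_of, sub_self]
    · change Nelt n * (1 - Yq n * Xq n) = 0
      rw [mul_sub, mul_one, Yq, Xq, ← map_mul, Nelt_mul_of, sub_self]

end QuaternionFox

theorem stmt15 (n : ℕ) [NeZero n] (hn : Odd n) :
    LinearMap.ker (d2 n) = Submodule.span (QR n) {sigma n} ∧
    ∃ e : (QR n ⧸ Ideal.span {Nelt n}) ≃ₗ[QR n] Submodule.span (QR n) {sigma n},
      e (Submodule.Quotient.mk 1) = ⟨sigma n, Submodule.mem_span_singleton_self (sigma n)⟩ := by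
  refine ⟨QuaternionFox.ker_d2 n, ?_⟩
  refine ⟨(Submodule.quotEquivOfEq _ _ (QuaternionFox.ker_toSpanSingleton_sigma n).symm).trans
    ((LinearMap.quotKerEquivRange _).trans
      (LinearEquiv.ofEq _ _ (LinearMap.range_toSpanSingleton (sigma n)))), ?_⟩
  apply Subtype.ext
  simp
end

section
/- With notation as above (n odd, gcd(a²+b²,2n)=1, P = ⟨a+by, x+1⟩, σ the generator of ker ∂₂), an element Cσ of ker ∂₂ (C ∈ ZQ_{4n}) lies in the submodule ZQ_{4n} ⊕ P of C₂(K̃) = ZQ_{4n} ⊕ ZQ_{4n} if and only if C ∈ P; hence (ZQ_{4n} ⊕ P) ∩ ker ∂₂ = Pσ. -/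
open MonoidAlgebra

noncomputable def Pideal (n : ℕ) (a b : ℤ) : Ideal (QR n) :=
  Ideal.span {(a : QR n) + (b : QR n) * Yq n, Xq n + 1}

section Coefficients

variable {n : ℕ}

theorem coeff_mul_of {G : Type*} [Group G] (p : MonoidAlgebra ℤ G) (g h : G) :
    (p * of ℤ G g).coeff h = p.coeff (h * g⁻¹) := by
  simp [of_apply]

theorem val_lt_or_val_add_lt (hn : 0 < n) (i : ZMod (2 * n)) :
    (i.val < n ∧ ¬ (i + n).val < n) ∨ (¬ i.val < n ∧ (i + n).val < n) := by
  have : NeZero (2 * n) := ⟨by omega⟩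
  have hi := ZMod.val_lt i
  have hv : (i + n).val = (i.val + n) % (2 * n) := by
    rw [ZMod.val_add, ZMod.val_natCast, Nat.mod_eq_of_lt (by omega : n < 2 * n)]
  rw [hv]
  rcases lt_or_ge i.val n with h | h
  · rw [Nat.mod_eq_of_lt (by omega)]; omega
  · rw [Nat.mod_eq_sub_mod (by omega), Nat.mod_eq_of_lt (by omega)]; omega

theorem natCast_add_natCast_self : (n : ZMod (2 * n)) + n = 0 := by
  have := ZMod.natCast_self (2 * n)
  push_cast at this
  linear_combination this

theorem neg_natCast_half : -(n : ZMod (2 * n)) = n :=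
  neg_eq_of_add_eq_zero_left natCast_add_natCast_self

theorem inv_a (i : ZMod (2 * n)) :
    (QuaternionGroup.a i)⁻¹ = QuaternionGroup.a (-i) :=
  rfl

theorem inv_xa (i : ZMod (2 * n)) :
    (QuaternionGroup.xa i)⁻¹ = QuaternionGroup.xa ((n : ZMod (2 * n)) + i) :=
  rfl

theorem exists_eq_mul_of_mul_one_add_half_eq_zero (hn : 0 < n) (w : QR n)
    (hw : w * (1 + of ℤ (QuaternionGroup n) (.a n)) = 0) :
    ∃ C, w = C * (1 - of ℤ (QuaternionGroup n) (.a n)) := by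
  classical
  let T : QuaternionGroup n → Prop
    | .a i => i.val < n
    | .xa i => i.val < n
  have hc (g) : w.coeff g + w.coeff (g * (.a n)⁻¹) = 0 := by
    have := congrArg (fun f => f.coeff g) hw
    simpa [mul_add, coeff_mul_of, -of_apply] using this
  refine ⟨ofCoeff (w.coeff.filter T), ?_⟩
  ext g
  have hg := hc g
  simp only [mul_sub, mul_one, coeff_sub, Finsupp.sub_apply, coeff_mul_of, Finsupp.filter_apply]
  rcases g with i | i <;>
    rcases val_lt_or_val_add_lt hn i with h | h <;>
    simp only [inv_a, neg_natCast_half, QuaternionGroup.a_mul_a, QuaternionGroup.xa_mul_a, T, h,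
      ↓reduceIte] at hg ⊢ <;> linarith

theorem exists_eq_mul_of_mul_one_add_xa_eq_zero (hn : 0 < n) (j : ZMod (2 * n)) (p : QR n)
    (hp : p * (1 + of ℤ (QuaternionGroup n) (.xa j)) = 0) :
    ∃ D, p = D * ((1 - of ℤ (QuaternionGroup n) (.xa j)) *
      (1 + of ℤ (QuaternionGroup n) (.a n))) := by
  classical
  let T : QuaternionGroup n → Prop
    | .a i => i.val < n
    | .xa _ => False
  have hc (g) : p.coeff g + p.coeff (g * (.xa j)⁻¹) = 0 := by
    have := congrArg (fun f => f.coeff g) hp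
    simpa [mul_add, coeff_mul_of, -of_apply] using this
  refine ⟨ofCoeff (p.coeff.filter T), ?_⟩
  ext g
  have h0 := hc g
  have h1 := hc (g * (.xa j)⁻¹)
  have h2 := hc (g * (.a n)⁻¹)
  simp only [← mul_assoc, mul_sub, mul_add, mul_one, coeff_sub, coeff_add, Finsupp.sub_apply,
    Finsupp.add_apply, coeff_mul_of, Finsupp.filter_apply]
  rcases g with i | i
  · have e : (n : ZMod (2 * n)) + (n + j) - (n + j - i) = i + n := by ring
    rcases val_lt_or_val_add_lt hn i with h | h <;>
    simp only [inv_a, inv_xa, neg_natCast_half, QuaternionGroup.a_mul_a,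
      QuaternionGroup.a_mul_xa, QuaternionGroup.xa_mul_xa, e, T, h,
      ↓reduceIte] at h0 h1 h2 ⊢ <;> linarith
  · have e : (n : ZMod (2 * n)) + (n + j) - i = j - i := by
      linear_combination natCast_add_natCast_self (n := n)
    have e' : (n : ZMod (2 * n)) + j - (j - i) = i + n := by ring
    have e'' : (n : ZMod (2 * n)) + (n + j) - (i + n) = j - i + n := by ring
    rcases val_lt_or_val_add_lt hn (j - i) with h | h <;>
    simp only [inv_a, inv_xa, neg_natCast_half, QuaternionGroup.xa_mul_a,
      QuaternionGroup.a_mul_xa, QuaternionGroup.xa_mul_xa, e, e', e'', T, h,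
      ↓reduceIte] at h0 h1 h2 ⊢ <;> linarith

theorem Xq_pow (k : ℕ) : Xq n ^ k = of ℤ (QuaternionGroup n) (.a k) := by
  rw [Xq, ← map_pow, QuaternionGroup.a_one_pow]

theorem Yq_mul_Xq : Yq n * Xq n = of ℤ (QuaternionGroup n) (.xa 1) := by
  rw [Xq, Yq, ← map_mul]; simp [-of_apply]

theorem coeff_sum_Xq_pow_a (hn : 0 < n) (i : ZMod (2 * n)) :
    (∑ k ∈ Finset.range (2 * n), Xq n ^ k).coeff (.a i) = 1 := by
  have : NeZero (2 * n) := ⟨by omega⟩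
  simp only [Xq_pow, of_apply, coeff_sum, Finsupp.finsetSum_apply, coeff_single,
    Finsupp.single_apply, QuaternionGroup.a.injEq]
  rw [Finset.sum_eq_single_of_mem i.val (Finset.mem_range.2 (ZMod.val_lt i))]
  · simp
  · intro k hk hki
    rw [if_neg]
    rintro rfl
    exact hki (ZMod.val_natCast_of_lt (Finset.mem_range.1 hk)).symm

theorem coeff_sum_Xq_pow_xa (i : ZMod (2 * n)) :
    (∑ k ∈ Finset.range (2 * n), Xq n ^ k).coeff (.xa i) = 0 := by
  simp [Xq_pow]

theorem eq_smul_norm_of_mul_Yq_of_mul_Xq (hn : 0 < n) (v : QR n) (hy : v * Yq n = v)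
    (hx : v * Xq n = v) :
    v = v.coeff 1 • ((∑ k ∈ Finset.range (2 * n), Xq n ^ k) * (1 + Yq n)) := by
  have : NeZero (2 * n) := ⟨by omega⟩
  have hxk (k : ℕ) : v * Xq n ^ k = v := by
    induction k with
    | zero => simp
    | succ k ih => rw [pow_succ, ← mul_assoc, ih, hx]
  have ha (i : ZMod (2 * n)) : v.coeff (.a i) = v.coeff 1 := by
    have := congrArg (fun f => f.coeff (.a i)) (hxk i.val)
    simpa [Xq_pow, coeff_mul_of, -of_apply, inv_a, QuaternionGroup.one_def,
      -QuaternionGroup.a_zero] using this.symm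
  have hxa (i : ZMod (2 * n)) : v.coeff (.xa i) = v.coeff 1 := by
    have := congrArg (fun f => f.coeff (.xa i)) hy
    simpa [Yq, coeff_mul_of, -of_apply, inv_xa, ha] using this.symm
  ext g
  rcases g with i | i
  · simp [mul_add, Yq, coeff_mul_of, -of_apply, inv_xa, coeff_sum_Xq_pow_a hn,
      coeff_sum_Xq_pow_xa, ha, -coeff_sum, -zsmul_eq_mul]
  · simp [mul_add, Yq, coeff_mul_of, -of_apply, inv_xa, coeff_sum_Xq_pow_a hn,
      coeff_sum_Xq_pow_xa, hxa, -coeff_sum, -zsmul_eq_mul]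

theorem exists_eq_add_mul_Xq_sub_one (hn : 0 < n) (E : QR n) :
    ∃ (α β : ℤ) (F : QR n), E = (α : QR n) + β * Yq n + F * (Xq n - 1) := by
  have : NeZero (2 * n) := ⟨by omega⟩
  induction E using MonoidAlgebra.induction_on with
  | of g =>
    have hk (k : ℕ) : ∃ F : QR n, Xq n ^ k = 1 + F * (Xq n - 1) :=
      ⟨_, by rw [geom_sum_mul]; abel⟩
    rcases g with i | i
    · obtain ⟨F, hF⟩ := hk i.val
      refine ⟨1, 0, F, ?_⟩
      rw [Xq_pow, ZMod.natCast_zmod_val] at hF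
      rw [hF]; simp
    · obtain ⟨F, hF⟩ := hk i.val
      refine ⟨0, 1, Yq n * F, ?_⟩
      rw [Xq_pow, ZMod.natCast_zmod_val] at hF
      have : of ℤ (QuaternionGroup n) (.xa i) = Yq n * of ℤ (QuaternionGroup n) (.a i) := by
        rw [Yq, ← map_mul]; simp [-of_apply]
      rw [this, hF]; simp [mul_add, mul_assoc]
  | add p q hp hq =>
    obtain ⟨α, β, F, rfl⟩ := hp
    obtain ⟨α', β', F', rfl⟩ := hq
    exact ⟨α + α', β + β', F + F', by push_cast; noncomm_ring⟩
  | smul r p hp =>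
    obtain ⟨α, β, F, rfl⟩ := hp
    exact ⟨r * α, r * β, r • F, by
      simp only [zsmul_eq_mul]; push_cast; noncomm_ring⟩

end Coefficients

section Relations

variable {n : ℕ}

theorem Xq_mul_Yq_mul_Xq : Xq n * Yq n * Xq n = Yq n := by
  simp only [Xq, Yq, ← map_mul]
  simp [-of_apply]

theorem Yq_mul_Yq : Yq n * Yq n = Xq n ^ n := by
  simp only [Xq_pow, Yq, ← map_mul]
  simp [-of_apply]

theorem Xq_pow_mul_self : Xq n ^ n * Xq n ^ n = 1 := by
  simp only [Xq_pow, ← map_mul, QuaternionGroup.a_mul_a, natCast_add_natCast_self,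
    QuaternionGroup.a_zero, map_one]

theorem commute_Xq_pow_Yq : Commute (Xq n ^ n) (Yq n) := by
  rw [← Yq_mul_Yq]
  exact (Commute.refl _).mul_left (Commute.refl _)

theorem commute_Xq_pow_Xq : Commute (Xq n ^ n) (Xq n) :=
  (Commute.refl _).pow_left n

theorem commute_one_add_Xq_pow_one_sub_Yq : Commute (1 + Xq n ^ n) (1 - Yq n) :=
  (Commute.one_left _).add_left ((Commute.one_right _).sub_right commute_Xq_pow_Yq)

theorem commute_one_add_Xq_pow_one_sub_Yq_mul_Xq :
    Commute (1 + Xq n ^ n) (1 - Yq n * Xq n) :=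
  (Commute.one_left _).add_left ((Commute.one_right _).sub_right
    (commute_Xq_pow_Yq.mul_right commute_Xq_pow_Xq))

theorem Yq_mul_Xq_mul_self : Yq n * Xq n * (Yq n * Xq n) = Xq n ^ n := by
  rw [mul_assoc, ← mul_assoc (Xq n), Xq_mul_Yq_mul_Xq, Yq_mul_Yq]

theorem Yq_mul_Xq_mul_Yq (hn : 0 < n) : Yq n * Xq n * Yq n = Xq n ^ (n - 1) := by
  rw [Yq_mul_Xq, Yq, Xq_pow, ← map_mul, QuaternionGroup.xa_mul_xa, Nat.cast_pred hn, add_zero]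

theorem sum_range_two_mul_Xq_pow :
    ∑ k ∈ Finset.range (2 * n), Xq n ^ k =
      (∑ k ∈ Finset.range n, Xq n ^ k) * (1 + Xq n ^ n) := by
  rw [two_mul, Finset.sum_range_add, mul_add, mul_one, Finset.sum_mul]
  congr 1
  exact Finset.sum_congr rfl fun k _ => by rw [← pow_add, add_comm]

theorem sum_range_Xq_pow_mul_Yq :
    (∑ k ∈ Finset.range n, Xq n ^ k) * (1 + Yq n) =
      ((∑ k ∈ Finset.range n, Xq n ^ k) - Yq n * Xq n + Xq n ^ n) * (1 + Yq n * Xq n) := by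
  have h := geom_sum_mul (Xq n) n
  set s := ∑ k ∈ Finset.range n, Xq n ^ k
  have hsx : s * Xq n = s + Xq n ^ n - 1 := by
    rw [add_sub_assoc, ← h]
    noncomm_ring
  have hsy : s * Yq n = (s + Xq n ^ n - 1) * (Yq n * Xq n) := by
    rw [← hsx, mul_assoc, ← mul_assoc (Xq n), Xq_mul_Yq_mul_Xq]
  have hu := Yq_mul_Xq_mul_self (n := n)
  rw [mul_add, hsy]
  simp only [add_mul, sub_mul, mul_add, hu, mul_one, one_mul]
  abel

theorem one_sub_Yq_mul_Xq_mul (hn : 0 < n) :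
    (1 - Yq n * Xq n) * (Yq n - ∑ k ∈ Finset.range (n - 1), Xq n ^ k) =
      -((1 - Yq n) * ∑ k ∈ Finset.range n, Xq n ^ k) := by
  obtain ⟨m, rfl⟩ : ∃ m, n = m + 1 := ⟨n - 1, by omega⟩
  have h := Yq_mul_Xq_mul_Yq hn
  have hr := geom_sum_succ (x := Xq (m + 1)) (n := m)
  have hl := Finset.sum_range_succ (fun k => Xq (m + 1) ^ k) m
  simp only [Nat.add_sub_cancel] at h ⊢
  rw [sub_mul 1 (Yq _) (Finset.sum _ _), one_mul]
  nth_rw 2 [hr]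
  rw [hl]
  simp only [sub_mul, mul_sub, mul_add, one_mul, mul_one, h, ← mul_assoc]
  abel

theorem Xq_sub_one_mul :
    (Xq n - 1) * ((1 - Yq n * Xq n) * (1 + Xq n ^ n)) =
      -((1 + Yq n) * (1 + Xq n ^ n) * (1 - Yq n * Xq n)) := by
  have hz : Xq n ^ n * (1 + Xq n ^ n) = 1 + Xq n ^ n := by
    rw [mul_add, Xq_pow_mul_self, mul_one, add_comm]
  have hx : Xq n ^ n * Xq n * (1 + Xq n ^ n) = Xq n * (1 + Xq n ^ n) := by
    rw [commute_Xq_pow_Xq.eq, mul_assoc, hz]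
  have e : (Xq n - 1) * (1 - Yq n * Xq n) = Xq n - 1 - Yq n + Yq n * Xq n := by
    simp only [sub_mul, mul_sub, mul_one, one_mul, ← mul_assoc, Xq_mul_Yq_mul_Xq]
    abel
  have e' : (1 + Yq n) * (1 - Yq n * Xq n) = 1 + Yq n - Yq n * Xq n - Xq n ^ n * Xq n := by
    simp only [add_mul, mul_sub, mul_one, one_mul, ← mul_assoc, Yq_mul_Yq]
    abel
  rw [mul_assoc (1 + Yq n), commute_one_add_Xq_pow_one_sub_Yq_mul_Xq.eq, ← mul_assoc,
    ← mul_assoc, e, e', sub_mul _ (_ * Xq n), hx]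
  simp only [add_mul, sub_mul]
  abel

end Relations

section Kernel

variable {n : ℕ}

theorem one_sub_Xq_pow_mul_one_add_Xq_pow : (1 - Xq n ^ n) * (1 + Xq n ^ n) = 0 := by
  simp only [sub_mul, mul_add, one_mul, mul_one, Xq_pow_mul_self]
  abel

theorem one_sub_mul_one_add_of_mul_self {A : Type*} [Ring A] {u z : A} (h : u * u = z) :
    (1 - u) * (1 + u) = 1 - z := by
  rw [← h]; noncomm_ring

theorem one_add_mul_one_sub_of_mul_self {A : Type*} [Ring A] {u z : A} (h : u * u = z) :
    (1 + u) * (1 - u) = 1 - z := by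
  rw [← h]; noncomm_ring

theorem one_add_mul_one_add_mul_self {A : Type*} [Ring A] {u z : A} (h : u * u = z)
    (hz : z * z = 1) : (1 + u) * (1 + z) * u = (1 + u) * (1 + z) := by
  have hc : z * u = u * z := by rw [← h, mul_assoc]
  have hu : u * (u * z) = 1 := by rw [← mul_assoc, h, hz]
  simp only [add_mul, mul_add, one_mul, mul_one, mul_assoc, hc, h, hu]
  abel

/-- The augmentation `ℤQ_{4n} → ℤ`. -/
noncomputable def augmentation (n : ℕ) : QR n →ₐ[ℤ] ℤ :=
  MonoidAlgebra.lift ℤ ℤ (QuaternionGroup n) 1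

@[simp]
theorem augmentation_Xq : augmentation n (Xq n) = 1 := by
  rw [augmentation, Xq, lift_of, MonoidHom.one_apply]

@[simp]
theorem augmentation_Yq : augmentation n (Yq n) = 1 := by
  rw [augmentation, Yq, lift_of, MonoidHom.one_apply]

theorem exists_eq_of_mul_norm_eq_zero (hn : 0 < n) (E : QR n)
    (hE : E * ((1 - Yq n) * ∑ k ∈ Finset.range (2 * n), Xq n ^ k) = 0) :
    ∃ (α : ℤ) (F : QR n), E = (α : QR n) * (1 + Yq n * Xq n) + F * (Xq n - 1) := by
  obtain ⟨α, β, F, rfl⟩ := exists_eq_add_mul_Xq_sub_one hn E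
  have hpow : Xq n ^ (2 * n) = 1 := by rw [two_mul, pow_add, Xq_pow_mul_self]
  have hxN := mul_geom_sum (Xq n) (2 * n)
  rw [hpow, sub_self] at hxN
  have hca := coeff_sum_Xq_pow_a hn
  have hcx := coeff_sum_Xq_pow_xa (n := n)
  set N := ∑ k ∈ Finset.range (2 * n), Xq n ^ k
  have hxN' : Xq n * N = N := by rwa [sub_mul, one_mul, sub_eq_zero] at hxN
  have hz (k : ℕ) : Xq n ^ k * N = N := by
    induction k with
    | zero => simp
    | succ k ih => rw [pow_succ, mul_assoc, hxN', ih]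
  have hXYN : Xq n * (Yq n * N) = Yq n * N := by
    have : Xq n * (Yq n * N) = Xq n * (Yq n * (Xq n * N)) := by rw [hxN']
    rw [this, ← mul_assoc, ← mul_assoc, Xq_mul_Yq_mul_Xq]
  have hF : F * (Xq n - 1) * ((1 - Yq n) * N) = 0 := by
    rw [mul_assoc, sub_mul 1, one_mul, mul_sub, sub_mul, sub_mul, one_mul, one_mul, hxN', hXYN]
    simp
  have hYYN : Yq n * (Yq n * N) = N := by rw [← mul_assoc, Yq_mul_Yq, hz]
  rw [add_mul, hF, add_zero] at hE
  have key : (α - β) • (N - Yq n * N) = 0 := by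
    rw [← hE, zsmul_eq_mul]
    simp only [add_mul, sub_mul, mul_sub, one_mul, mul_assoc, hYYN, Int.cast_sub]
    abel
  have hab := congrArg (fun f => f.coeff 1) key
  have h1 : (N - Yq n * N).coeff 1 = 1 := by
    have : (Yq n * N).coeff 1 = 0 := by
      rw [Yq, of_apply, QuaternionGroup.one_def]
      simp [hcx, inv_xa]
    rw [coeff_sub, Finsupp.sub_apply, this, QuaternionGroup.one_def, hca, sub_zero]
  simp only [coeff_smul_apply, h1, coeff_zero, Finsupp.zero_apply, smul_eq_mul, mul_one] at hab
  obtain rfl : α = β := by omega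
  refine ⟨α, F - α * Yq n, ?_⟩
  simp only [sub_mul, mul_sub, mul_add, mul_one, mul_assoc]
  abel

theorem d2_apply (p q : QR n) :
    d2 n (p, q) = (p * (∑ k ∈ Finset.range n, Xq n ^ k) +
      q * (Yq n - ∑ k ∈ Finset.range (n - 1), Xq n ^ k),
      p * (-1 - Yq n) + q * (1 + Yq n * Xq n)) :=
  rfl

theorem d2_smul_sigma (hn : 0 < n) (C : QR n) : d2 n (C • sigma n) = 0 := by
  have h1 : (1 - Yq n) * (-1 - Yq n) = -(1 - Xq n ^ n) := by
    rw [← one_sub_mul_one_add_of_mul_self Yq_mul_Yq]; noncomm_ring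
  rw [map_smul, sigma, d2_apply, one_sub_Yq_mul_Xq_mul hn, add_neg_cancel, h1,
    one_sub_mul_one_add_of_mul_self Yq_mul_Xq_mul_self, neg_add_cancel, Prod.mk_zero_zero,
    smul_zero]

theorem exists_eq_smul_sigma_of_d2_eq_zero (hn : 0 < n) (p q : QR n) (h : d2 n (p, q) = 0) :
    ∃ C : QR n, (p, q) = C • sigma n := by
  rw [d2_apply, Prod.mk_eq_zero] at h
  obtain ⟨heq1, heq2⟩ := h
  have hw : q * (1 + Yq n * Xq n) = p * (1 + Yq n) := by
    rw [← sub_eq_zero, ← heq2]; noncomm_ring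
  have hzz := Xq_pow_mul_self (n := n)
  have hyy := Yq_mul_Yq (n := n)
  have huu := Yq_mul_Xq_mul_self (n := n)
  have hcY : Commute (1 + Xq n ^ n) (1 + Yq n) :=
    (Commute.one_left _).add_left ((Commute.one_right _).add_right commute_Xq_pow_Yq)
  -- The common value `p (1 + y) = q (1 + yx)` becomes `G`-invariant after multiplying by `1 + z`.
  have hvY : p * (1 + Yq n) * (1 + Xq n ^ n) * Yq n = p * (1 + Yq n) * (1 + Xq n ^ n) := by
    rw [mul_assoc p, mul_assoc p, one_add_mul_one_add_mul_self hyy hzz]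
  have hvU : p * (1 + Yq n) * (1 + Xq n ^ n) * (Yq n * Xq n) =
      p * (1 + Yq n) * (1 + Xq n ^ n) := by
    rw [← hw, mul_assoc q, mul_assoc q, one_add_mul_one_add_mul_self huu hzz]
  have hvX : p * (1 + Yq n) * (1 + Xq n ^ n) * Xq n = p * (1 + Yq n) * (1 + Xq n ^ n) := by
    rwa [← mul_assoc, hvY] at hvU
  have hv := eq_smul_norm_of_mul_Yq_of_mul_Xq hn _ hvY hvX
  generalize (p * (1 + Yq n) * (1 + Xq n ^ n)).coeff 1 = m at hv
  rw [sum_range_two_mul_Xq_pow] at hv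
  have hI := sum_range_Xq_pow_mul_Yq (n := n)
  have hII := one_sub_Yq_mul_Xq_mul hn
  have hεs : augmentation n (∑ k ∈ Finset.range n, Xq n ^ k) = n := by simp
  have hεs' : augmentation n (∑ k ∈ Finset.range (n - 1), Xq n ^ k) = n - 1 := by
    simp [Nat.cast_pred hn]
  have hNs := sum_range_two_mul_Xq_pow (n := n)
  have hsz : Commute (∑ k ∈ Finset.range n, Xq n ^ k) (1 + Xq n ^ n) :=
    (Commute.one_right _).add_right
      (Commute.sum_left _ _ _ fun k _ => (Commute.refl (Xq n)).pow_pow k n)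
  set s := ∑ k ∈ Finset.range n, Xq n ^ k
  set s' := ∑ k ∈ Finset.range (n - 1), Xq n ^ k
  obtain ⟨C, hC⟩ := exists_eq_mul_of_mul_one_add_half_eq_zero hn
    (p * (1 + Yq n) - m • (s * (1 + Yq n))) (by
      rw [← Xq_pow, sub_mul, hv, smul_mul_assoc, mul_assoc, mul_assoc, hcY.eq, sub_self])
  rw [← Xq_pow] at hC
  obtain ⟨D, hD⟩ := exists_eq_mul_of_mul_one_add_xa_eq_zero hn 0
    (p - m • s - C * (1 - Yq n)) (by
      change _ * (1 + Yq n) = 0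
      rw [sub_mul, sub_mul, smul_mul_assoc, hC, mul_assoc, one_sub_mul_one_add_of_mul_self hyy,
        sub_self])
  obtain ⟨E, hE⟩ := exists_eq_mul_of_mul_one_add_xa_eq_zero hn 1
    (q - m • (s - Yq n * Xq n + Xq n ^ n) - C * (1 - Yq n * Xq n)) (by
      rw [← Yq_mul_Xq, sub_mul, sub_mul, smul_mul_assoc, ← hI, hw, hC, mul_assoc,
        one_sub_mul_one_add_of_mul_self huu, sub_self])
  rw [← Xq_pow] at hD hE
  rw [← Yq_mul_Xq] at hE
  change _ = D * ((1 - Yq n) * _) at hD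
  have hp : p = m • s + C * (1 - Yq n) + D * ((1 - Yq n) * (1 + Xq n ^ n)) := by
    rw [← hD]; abel
  have hq : q = m • (s - Yq n * Xq n + Xq n ^ n) + C * (1 - Yq n * Xq n) +
      E * ((1 - Yq n * Xq n) * (1 + Xq n ^ n)) := by
    rw [← hE]; abel
  -- Augmenting the first equation kills the invariant part.
  have hm : m = 0 := by
    have h := congrArg (augmentation n) heq1
    rw [hp, hq] at h
    simp only [map_add, map_mul, map_sub, map_one, map_pow, map_zsmul, map_zero, augmentation_Xq,
      augmentation_Yq, hεs, hεs', smul_eq_mul, one_pow] at h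
    have h2 : m * (2 * n) = 0 := by linear_combination h
    have : (2 * n : ℤ) ≠ 0 := by positivity
    exact (mul_eq_zero.1 h2).resolve_right this
  subst hm
  rw [zero_smul, zero_add] at hp hq
  have hED : (E - D) * ((1 - Yq n) * ∑ k ∈ Finset.range (2 * n), Xq n ^ k) = 0 := by
    have h1 : (1 - Yq n) * (1 + Xq n ^ n) * s = (1 - Yq n) * (s * (1 + Xq n ^ n)) := by
      rw [mul_assoc, hsz.eq]
    have h2 : (1 - Yq n * Xq n) * (1 + Xq n ^ n) * (Yq n - s') =
        -((1 - Yq n) * (s * (1 + Xq n ^ n))) := by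
      rw [← commute_one_add_Xq_pow_one_sub_Yq_mul_Xq.eq, mul_assoc, hII, mul_neg, ← mul_assoc,
        commute_one_add_Xq_pow_one_sub_Yq.eq, h1]
    rw [hp, hq, add_mul, add_mul, mul_assoc C, mul_assoc C, hII, mul_assoc D, mul_assoc E, h1, h2]
      at heq1
    rw [hNs, sub_mul, ← neg_eq_zero, ← heq1, mul_neg, mul_neg]
    abel
  obtain ⟨α, F, hF⟩ := exists_eq_of_mul_norm_eq_zero hn _ hED
  have hEF : E = D + (α * (1 + Yq n * Xq n) + F * (Xq n - 1)) := by rw [← hF]; abel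
  refine ⟨C + D * (1 + Xq n ^ n) - F * ((1 + Yq n) * (1 + Xq n ^ n)), ?_⟩
  rw [sigma, Prod.smul_mk, smul_eq_mul, smul_eq_mul, Prod.mk.injEq]
  constructor
  · have h1 : (1 + Yq n) * (1 + Xq n ^ n) * (1 - Yq n) = 0 := by
      rw [mul_assoc, commute_one_add_Xq_pow_one_sub_Yq.eq, ← mul_assoc,
        one_add_mul_one_sub_of_mul_self hyy, one_sub_Xq_pow_mul_one_add_Xq_pow]
    rw [hp, sub_mul (C + _), add_mul C, mul_assoc F, h1, mul_zero, sub_zero, mul_assoc D,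
      commute_one_add_Xq_pow_one_sub_Yq.eq]
  · have h1 : (1 + Yq n * Xq n) * ((1 - Yq n * Xq n) * (1 + Xq n ^ n)) = 0 := by
      rw [← mul_assoc, one_add_mul_one_sub_of_mul_self huu, one_sub_Xq_pow_mul_one_add_Xq_pow]
    rw [hq, hEF, add_mul D, add_mul (_ * _), mul_assoc (α : QR n), h1, mul_zero, zero_add,
      mul_assoc F, Xq_sub_one_mul, sub_mul (C + _), add_mul C, mul_assoc D, mul_assoc F,
      commute_one_add_Xq_pow_one_sub_Yq_mul_Xq.eq, mul_neg]
    abel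

end Kernel

section Ideal

variable {n : ℕ} {a b : ℤ}

theorem mul_Xq_add_one_mem (r : QR n) : r * (Xq n + 1) ∈ Pideal n a b :=
  Ideal.mul_mem_left _ _ (Ideal.subset_span (by simp))

theorem mul_add_mul_Yq_mem (r : QR n) : r * ((a : QR n) + b * Yq n) ∈ Pideal n a b :=
  Ideal.mul_mem_left _ _ (Ideal.subset_span (by simp))

/-- `P` is stable under right multiplication by `yx`. -/
theorem mul_Yq_mul_Xq_mem {C : QR n} (hC : C ∈ Pideal n a b) :
    C * (Yq n * Xq n) ∈ Pideal n a b := by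
  obtain ⟨r, t, rfl⟩ := Submodule.mem_span_pair.1 hC
  have h1 : ((a : QR n) + b * Yq n) * (Yq n * Xq n) =
      (a + b * Yq n) * Yq n * (Xq n + 1) - Yq n * (a + b * Yq n) := by
    have ha := (Int.cast_commute a (Yq n)).eq
    have hb := (Int.cast_commute b (Yq n)).eq
    have : Yq n * (a + b * Yq n) = (a + b * Yq n) * Yq n := by
      rw [mul_add, add_mul, ← ha, ← mul_assoc, ← hb]
    rw [this, mul_add _ (Xq n), mul_one, add_sub_cancel_right, mul_assoc _ (Yq n)]
  have h2 : (Xq n + 1) * (Yq n * Xq n) = Yq n * (Xq n + 1) := by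
    rw [add_mul, ← mul_assoc, Xq_mul_Yq_mul_Xq, one_mul, mul_add, mul_one, add_comm]
  rw [smul_eq_mul, smul_eq_mul, add_mul, mul_assoc, mul_assoc, h1, h2]
  exact add_mem
    (Ideal.mul_mem_left _ r (sub_mem (mul_Xq_add_one_mem _) (mul_add_mul_Yq_mem _)))
    (Ideal.mul_mem_left _ t (mul_Xq_add_one_mem _))

theorem mul_one_add_Xq_pow_mem (hn : Odd n) (C : QR n) :
    C * (1 + Xq n ^ n) ∈ Pideal n a b := by
  have h : (∑ i ∈ Finset.range n, (-Xq n) ^ i) * (Xq n + 1) = 1 + Xq n ^ n := by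
    have h := geom_sum_mul (-Xq n) n
    rw [hn.neg_pow, ← neg_add', ← neg_add', mul_neg, neg_inj] at h
    rw [h, add_comm]
  rw [← h, ← mul_assoc]
  exact mul_Xq_add_one_mem _

theorem mul_one_sub_Yq_mul_Xq_mem_iff (hn : Odd n)
    (hco : Int.gcd (a ^ 2 + b ^ 2) (2 * n) = 1) (C : QR n) :
    C * (1 - Yq n * Xq n) ∈ Pideal n a b ↔ C ∈ Pideal n a b := by
  refine ⟨fun h => ?_, fun h => ?_⟩
  · have h2 : C * 2 ∈ Pideal n a b := by
      have := add_mem (add_mem h (mul_Yq_mul_Xq_mem h)) (mul_one_add_Xq_pow_mem hn C)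
      have e : C * (1 - Yq n * Xq n) + C * (1 - Yq n * Xq n) * (Yq n * Xq n) +
          C * (1 + Xq n ^ n) = C * 2 := by
        rw [← Yq_mul_Xq_mul_self]; noncomm_ring
      rwa [e] at this
    have hab : C * ((a ^ 2 + b ^ 2 : ℤ) : QR n) ∈ Pideal n a b := by
      have := add_mem (mul_add_mul_Yq_mem (a := a) (b := b) (C * ((a : QR n) - (b : QR n) * Yq n)))
        (mul_one_add_Xq_pow_mem (a := a) (b := b) hn (C * ((b * b : ℤ) : QR n)))
      have e : C * ((a : QR n) - (b : QR n) * Yq n) * (a + b * Yq n) + C * ((b * b : ℤ) : QR n) * (1 + Xq n ^ n) =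
          C * ((a ^ 2 + b ^ 2 : ℤ) : QR n) := by
        have ha := (Int.cast_commute a (Yq n)).eq
        have hb := (Int.cast_commute b (Yq n)).eq
        have hab := (Int.cast_commute a (b : QR n)).eq
        have e1 : (b : QR n) * Yq n * a = a * (b * Yq n) := by
          rw [mul_assoc, ← ha, ← mul_assoc, ← hab, mul_assoc]
        have e2 : (b : QR n) * Yq n * (b * Yq n) = b * b * Xq n ^ n := by
          rw [← Yq_mul_Yq, mul_assoc, ← mul_assoc (Yq n), ← hb]; noncomm_ring
        rw [mul_assoc, mul_assoc, ← mul_add]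
        congr 1
        simp only [sub_mul, mul_add, e1, e2]
        push_cast
        noncomm_ring
      rwa [e] at this
    have hcop : IsCoprime (a ^ 2 + b ^ 2) (2 : ℤ) :=
      (Int.isCoprime_iff_gcd_eq_one.2 hco).of_mul_right_left
    obtain ⟨r, t, hrt⟩ := hcop
    have := add_mem (Ideal.mul_mem_left _ (r : QR n) hab) (Ideal.mul_mem_left _ (t : QR n) h2)
    have e : (r : QR n) * (C * ((a ^ 2 + b ^ 2 : ℤ) : QR n)) + t * (C * 2) = C := by
      have hr := (Int.cast_commute r C).eq
      have ht := (Int.cast_commute t C).eq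
      rw [← mul_assoc, ← mul_assoc, hr, ht, mul_assoc, mul_assoc, ← mul_add]
      have := congrArg (Int.cast : ℤ → QR n) hrt
      rw [Int.cast_add, Int.cast_mul, Int.cast_mul, Int.cast_one, Int.cast_ofNat] at this
      rw [this, mul_one]
    rwa [e] at this
  · rw [mul_sub, mul_one]
    exact sub_mem h (mul_Yq_mul_Xq_mem h)

end Ideal

/-- An element `C•σ` of `ker ∂₂` lies in the submodule `ℤQ_{4n} ⊕ P` of
`C₂(K̃) = ℤQ_{4n} ⊕ ℤQ_{4n}` iff `C ∈ P`; hence `(ℤQ_{4n} ⊕ P) ∩ ker ∂₂ = Pσ`. -/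
theorem stmt16 (n : ℕ) (a b : ℤ) (hn : Odd n)
    (hco : Int.gcd (a ^ 2 + b ^ 2) (2 * n) = 1) :
    (∀ C : QR n, C • sigma n ∈
      (Submodule.prod ⊤ (Pideal n a b) : Submodule (QR n) (QR n × QR n)) ↔ C ∈ Pideal n a b) ∧
    (Submodule.prod ⊤ (Pideal n a b) : Submodule (QR n) (QR n × QR n)) ⊓ LinearMap.ker (d2 n) =
      Submodule.map (LinearMap.toSpanSingleton (QR n) (QR n × QR n) (sigma n))
        (Pideal n a b) := by
  have hpos : 0 < n := hn.pos
  have hiff (C : QR n) : C • sigma n ∈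
      (Submodule.prod ⊤ (Pideal n a b) : Submodule (QR n) (QR n × QR n)) ↔
        C ∈ Pideal n a b := by
    rw [← mul_one_sub_Yq_mul_Xq_mem_iff hn hco C, Submodule.mem_prod]
    simp [sigma]
  refine ⟨hiff, Submodule.ext fun ⟨p, q⟩ => ?_⟩
  simp only [Submodule.mem_inf, LinearMap.mem_ker, Submodule.mem_map,
    LinearMap.toSpanSingleton_apply]
  constructor
  · rintro ⟨hmem, hker⟩
    obtain ⟨C, hC⟩ := exists_eq_smul_sigma_of_d2_eq_zero hpos p q hker
    rw [hC] at hmem ⊢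
    exact ⟨C, (hiff C).1 hmem, rfl⟩
  · rintro ⟨C, hC, h⟩
    rw [← h]
    exact ⟨(hiff C).2 hC, d2_smul_sigma hpos C⟩
end
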